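/- arXiv:1606.03156 — 3 statements merged into one kernel-verified Lean document; each statement's English description precedes it below -/
import Mathlib

section
/- For every α > 0, the function t ↦ (1 − cos(α t))/(π t²) (extended by the value α²/(2π) at t = 0) is Lebesgue integrable on ℝ and ∫_ℝ (1 − cos(α t))/(π t²) dt = α. -/
open MeasureTheory Real
open scoped FourierTransform

/-- The Fejér-type kernel is integrable. -/
theorem integrable_fejerKernel (α : ℝ) : Integrable (fun t : ℝ =>
      if t = 0 then α ^ 2 / (2 * π) else (1 - Real.cos (α * t)) / (π * t ^ 2)) := by
  refine (integrable_inv_one_add_sq.const_mul (α ^ 2 / (2 * π) + 2 / π)).mono' ?_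
    (Filter.Eventually.of_forall fun t => ?_)
  · exact (Measurable.ite (measurableSet_singleton 0) measurable_const
      (by fun_prop)).aestronglyMeasurable
  · have hπ := Real.pi_pos
    have h1 := Real.one_sub_sq_div_two_le_cos (x := α * t)
    have h2 := Real.neg_one_le_cos (α * t)
    have h3 := Real.cos_le_one (α * t)
    rw [← div_eq_mul_inv, le_div_iff₀ (by positivity)]
    split_ifs with ht
    · subst ht
      rw [Real.norm_of_nonneg (by positivity)]
      have : 0 < 2 / π := by positivity
      linarith
    · have ht2 : 0 < t ^ 2 := by positivity
      rw [Real.norm_of_nonneg (div_nonneg (by linarith) (by positivity)), div_mul_eq_mul_div,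
        div_le_iff₀ (by positivity)]
      have : (α ^ 2 / (2 * π) + 2 / π) * (π * t ^ 2) = (α ^ 2 * t ^ 2) / 2 + 2 * t ^ 2 := by
        field_simp
      rw [this]
      nlinarith

/-- Laplace-type integral of the affine function `α - 2πx` over `[0, α / (2π)]`. -/
theorem integral_cexp_mul_affine {c : ℂ} (hc : c ≠ 0) (α a : ℝ) (ha : α = 2 * π * a) :
    ∫ x in (0 : ℝ)..a, Complex.exp (-(c * x)) * (α - 2 * π * x) =
      2 * π * Complex.exp (-(c * a)) / c ^ 2 + α / c - 2 * π / c ^ 2 := by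
  have hd (x : ℝ) : HasDerivAt (fun x : ℝ => -(Complex.exp (-(c * x)) * (α - 2 * π * x)) / c
      + 2 * π * Complex.exp (-(c * x)) / c ^ 2) (Complex.exp (-(c * x)) * (α - 2 * π * x)) x := by
    have hx : HasDerivAt (fun x : ℝ => (x : ℂ)) 1 x := Complex.ofRealCLM.hasDerivAt
    have he := (hx.const_mul c).neg.cexp
    have hl := (hx.const_mul (2 * π : ℂ)).const_sub (α : ℂ)
    refine (((he.mul hl).neg.div_const c).add
      ((he.const_mul (2 * π : ℂ)).div_const (c ^ 2))).congr_deriv ?_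
    simp only [Pi.neg_apply]
    field_simp
    ring
  rw [intervalIntegral.integral_eq_sub_of_hasDerivAt (fun x _ => hd x)
    (Continuous.intervalIntegrable (by fun_prop) _ _)]
  subst ha
  push_cast
  simp
  ring

/-- Folding an integral against the triangle function `max (α - 2π|x|) 0` onto the half-line. -/
theorem integral_max_mul_eq {α : ℝ} (hα : 0 < α) {f : ℝ → ℂ} (hf : Continuous f) :
    ∫ x : ℝ, f x * (max (α - 2 * π * |x|) 0 : ℝ) =
      ∫ x in (0 : ℝ)..(α / (2 * π)), (f x + f (-x)) * (α - 2 * π * x) := by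
  have hπ := Real.pi_pos
  set a := α / (2 * π) with ha
  have ha0 : 0 < a := by positivity
  have haα : α = 2 * π * a := by rw [ha]; field_simp
  have hs : Function.support (fun x : ℝ => f x * (max (α - 2 * π * |x|) 0 : ℝ)) ⊆
      Set.Ioc (-a) a := by
    intro x hx
    by_contra hn
    apply hx
    have : a ≤ |x| := by
      by_contra! h
      exact hn ⟨(abs_lt.1 h).1, (abs_lt.1 h).2.le⟩
    have : α - 2 * π * |x| ≤ 0 := by rw [haα]; nlinarith
    simp [max_eq_right this]
  have hc : Continuous (fun x : ℝ => f x * (max (α - 2 * π * |x|) 0 : ℝ)) := by fun_prop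
  rw [← intervalIntegral.integral_eq_integral_of_support_subset hs,
    ← intervalIntegral.integral_add_adjacent_intervals (b := 0)
      (hc.intervalIntegrable _ _) (hc.intervalIntegrable _ _)]
  have hn := intervalIntegral.integral_comp_neg (a := 0) (b := a)
    (fun x : ℝ => f x * (max (α - 2 * π * |x|) 0 : ℝ))
  rw [neg_zero] at hn
  have hc' : Continuous (fun x : ℝ => f (-x) * (max (α - 2 * π * |-x|) 0 : ℝ)) := by fun_prop
  rw [← hn, ← intervalIntegral.integral_add (hc'.intervalIntegrable _ _)
    (hc.intervalIntegrable _ _)]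
  refine intervalIntegral.integral_congr fun x hx => ?_
  rw [Set.uIcc_of_le ha0.le] at hx
  have : 0 ≤ α - 2 * π * x := by rw [haα]; nlinarith [hx.2]
  simp only [abs_neg, abs_of_nonneg hx.1, max_eq_left this]
  push_cast
  ring

/-- The Fourier transform of the triangle function is the Fejér-type kernel. -/
theorem fourier_max_sub_abs {α : ℝ} (hα : 0 < α) :
    𝓕 (fun x : ℝ => ((max (α - 2 * π * |x|) 0 : ℝ) : ℂ)) = fun t : ℝ =>
      ((if t = 0 then α ^ 2 / (2 * π) else (1 - Real.cos (α * t)) / (π * t ^ 2) : ℝ) : ℂ) := by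
  have hπ := Real.pi_pos
  have hπ' : (π : ℂ) ≠ 0 := by exact_mod_cast hπ.ne'
  have haα : α = 2 * π * (α / (2 * π)) := by field_simp
  ext t
  rw [Real.fourier_real_eq_integral_exp_smul]
  simp only [smul_eq_mul]
  rw [integral_max_mul_eq hα (by fun_prop)]
  split_ifs with ht
  · subst ht
    simp only [mul_zero, Complex.ofReal_zero, zero_mul, Complex.exp_zero]
    have : ∫ x in (0 : ℝ)..(α / (2 * π)), ((1 : ℂ) + 1) * (α - 2 * π * x) =
        ((∫ x in (0 : ℝ)..(α / (2 * π)), 2 * (α - 2 * π * x) : ℝ) : ℂ) := by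
      rw [← intervalIntegral.integral_ofReal]
      congr 1; ext x; push_cast; ring
    rw [this, intervalIntegral.integral_const_mul,
      intervalIntegral.integral_sub (by simp)
        (Continuous.intervalIntegrable (by fun_prop) _ _),
      intervalIntegral.integral_const_mul, integral_id, intervalIntegral.integral_const]
    congr 1
    simp only [smul_eq_mul]
    field_simp
    ring
  · have ht' : (t : ℂ) ≠ 0 := by exact_mod_cast ht
    set c : ℂ := 2 * π * t * Complex.I with hcdef
    have hc : c ≠ 0 := by simp [hcdef, hπ', ht']
    have h1 := integral_cexp_mul_affine hc α _ haα
    have h2 := integral_cexp_mul_affine (neg_ne_zero.2 hc) α _ haα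
    have hi (d : ℂ) : IntervalIntegrable (fun x : ℝ => Complex.exp (-(d * x)) * (α - 2 * π * x))
      volume 0 (α / (2 * π)) := Continuous.intervalIntegrable (by fun_prop) _ _
    have hca : c * (α / (2 * π) : ℝ) = (α * t : ℝ) * Complex.I := by
      rw [hcdef]; push_cast; field_simp
    have hc2 : c ^ 2 = -(4 * π ^ 2 * t ^ 2) := by
      rw [hcdef, mul_pow, Complex.I_sq]; ring
    trans (∫ x in (0 : ℝ)..(α / (2 * π)), Complex.exp (-(c * x)) * (α - 2 * π * x)) +
      ∫ x in (0 : ℝ)..(α / (2 * π)), Complex.exp (-(-c * x)) * (α - 2 * π * x)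
    · rw [← intervalIntegral.integral_add (hi _) (hi _)]
      congr 1; ext x
      rw [← add_mul, hcdef]
      push_cast
      congr 3 <;> ring_nf
    · rw [h1, h2, neg_mul, neg_neg, neg_sq, hca, hc2]
      push_cast
      rw [div_neg (α : ℂ), Complex.cos, neg_mul]
      field_simp
      ring

/-- The Fejér-type kernel `K_α(t) = (1 − cos(α t))/(π t²)` (with value `α²/(2π)` at `0`)
is integrable on `ℝ` with total integral `α`. -/
theorem fejerKernel_integrable_and_integral_eq (α : ℝ) (hα : 0 < α) :
    Integrable (fun t : ℝ =>
      if t = 0 then α ^ 2 / (2 * π) else (1 - Real.cos (α * t)) / (π * t ^ 2)) ∧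
    ∫ t : ℝ,
      (if t = 0 then α ^ 2 / (2 * π) else (1 - Real.cos (α * t)) / (π * t ^ 2)) = α := by
  have hK := integrable_fejerKernel α
  refine ⟨hK, ?_⟩
  have hπ := Real.pi_pos
  have hc : Continuous (fun x : ℝ => ((max (α - 2 * π * |x|) 0 : ℝ) : ℂ)) := by fun_prop
  have hg : Integrable (fun x : ℝ => ((max (α - 2 * π * |x|) 0 : ℝ) : ℂ)) := by
    refine hc.integrable_of_hasCompactSupport
      (HasCompactSupport.intro (isCompact_Icc (a := -(α / (2 * π))) (b := α / (2 * π))) ?_)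
    intro x hx
    rw [Set.mem_Icc, ← abs_le, not_le, div_lt_iff₀ (by positivity)] at hx
    rw [max_eq_right (by linarith), Complex.ofReal_zero]
  have hF := fourier_max_sub_abs hα
  have hinv := congrFun (hc.fourierInv_fourier_eq hg (hF ▸ hK.ofReal)) 0
  rw [hF, Real.fourierInv_eq'] at hinv
  simp only [inner_zero_right, mul_zero, Complex.ofReal_zero, zero_mul, Complex.exp_zero, one_smul,
    abs_zero, sub_zero, max_eq_left hα.le] at hinv
  rw [integral_complex_ofReal] at hinv
  exact_mod_cast hinv
end

section
/- Let δ > 0 and let f : ℝ → ℝ be defined by f(t) = (π δ)^{−1/4} · exp(−t²/(2δ)). Then ∫_ℝ f(t)² · (1 − e^{−δ/8 + t/2})² dt = 2(1 − e^{−δ/16}), and this quantity is strictly less than δ/8. -/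
open MeasureTheory Real

/-- The square of the normalized Gaussian is the density of the centred Gaussian law of
variance `δ / 2`. -/
lemma normalized_gaussian_sq_eq_gaussianPDFReal {δ : ℝ} (hδ : 0 < δ) (t : ℝ) :
    ((π * δ) ^ (-(1/4 : ℝ)) * Real.exp (-t ^ 2 / (2 * δ))) ^ 2 =
      ProbabilityTheory.gaussianPDFReal 0 (δ / 2).toNNReal t := by
  have hv : (((δ / 2).toNNReal : NNReal) : ℝ) = δ / 2 := Real.coe_toNNReal _ (by positivity)
  have hπδ : 0 ≤ π * δ := by positivity
  rw [ProbabilityTheory.gaussianPDFReal, hv, mul_pow]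
  congr 1
  · rw [← Real.rpow_natCast, ← Real.rpow_mul hπδ, Real.sqrt_eq_rpow,
      show 2 * π * (δ / 2) = π * δ by ring, ← Real.rpow_neg hπδ]
    norm_num
  · rw [← Real.exp_nat_mul]
    congr 1
    field_simp
    norm_num

/-- For the normalized Gaussian `f(t) = (π δ)^{−1/4} e^{−t²/(2δ)}`,
`∫ f(t)² (1 − e^{−δ/8 + t/2})² dt = 2(1 − e^{−δ/16}) < δ/8`. -/
theorem gaussian_sq_one_sub_exp_integral (δ : ℝ) (hδ : 0 < δ) :
    (∫ t : ℝ,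
        ((π * δ) ^ (-(1/4 : ℝ)) * Real.exp (-t ^ 2 / (2 * δ))) ^ 2 *
          (1 - Real.exp (-δ / 8 + t / 2)) ^ 2
      = 2 * (1 - Real.exp (-δ / 16))) ∧
    2 * (1 - Real.exp (-δ / 16)) < δ / 8 := by
  constructor
  · have hv : (δ / 2).toNNReal ≠ 0 := (Real.toNNReal_pos.mpr (by positivity)).ne'
    set ν := ProbabilityTheory.gaussianReal 0 (δ / 2).toNNReal with hν
    have hint (s : ℝ) : Integrable (fun t => Real.exp (s * t)) ν :=
      ProbabilityTheory.integrable_exp_mul_gaussianReal s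
    have hmgf (s : ℝ) : ∫ t, Real.exp (s * t) ∂ν = Real.exp (δ * s ^ 2 / 4) := by
      have h := congrFun (ProbabilityTheory.mgf_id_gaussianReal (μ := 0)
        (v := (δ / 2).toNNReal)) s
      rw [Real.coe_toNNReal _ (by positivity)] at h
      refine Eq.trans h ?_
      congr 1
      ring
    have hexpand (t : ℝ) : (1 - Real.exp (-δ / 8 + t / 2)) ^ 2 =
        1 - 2 * Real.exp (-δ / 8) * Real.exp (1 / 2 * t)
          + Real.exp (-δ / 4) * Real.exp (1 * t) := by
      rw [mul_assoc, ← Real.exp_add, ← Real.exp_add, sub_sq, ← Real.exp_nat_mul]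
      push_cast
      ring_nf
    simp_rw [normalized_gaussian_sq_eq_gaussianPDFReal hδ]
    have h := ProbabilityTheory.integral_gaussianReal_eq_integral_smul (μ := 0) hv
      (f := fun t : ℝ => (1 - Real.exp (-δ / 8 + t / 2)) ^ 2)
    simp only [smul_eq_mul] at h
    rw [← h, ← hν]
    simp_rw [hexpand]
    have hlin : Integrable (fun t => 1 - 2 * Real.exp (-δ / 8) * Real.exp (1 / 2 * t)) ν :=
      (integrable_const _).sub ((hint _).const_mul _)
    rw [integral_add hlin ((hint _).const_mul _),
      integral_sub (integrable_const _) ((hint _).const_mul _), integral_const_mul,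
      integral_const_mul, hmgf, hmgf, mul_assoc, ← Real.exp_add, ← Real.exp_add]
    have h₁ : -δ / 8 + δ * (1 / 2) ^ 2 / 4 = -δ / 16 := by ring
    have h₂ : -δ / 4 + δ * 1 ^ 2 / 4 = 0 := by ring
    rw [h₁, h₂]
    simp
    ring
  · have h := Real.add_one_lt_exp (x := -δ / 16) (by linarith)
    linarith
end

section
/- Let A be a unital C*-algebra and let ψ : A → ℂ be a state, i.e., a linear functional with ψ(1) = 1 and ψ(x* x) ≥ 0 for all x ∈ A. Let y ∈ A with ‖y‖ ≤ 1 and let v ∈ A be a unitary such that y = v · (y* y)^{1/2}, where (y* y)^{1/2} is the positive square root given by the continuous functional calculus. Then ψ((v − y)*(v − y)) = ψ((1 − |y|)²) ≤ 1 − ψ(y* y), where |y| = (y* y)^{1/2}. Consequently, if 0 < ε < 1 and ψ(y* y)^{1/2} > 1 − ε²/8, then ψ((v − y)*(v − y)) < ε²/4. -/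
open scoped ComplexOrder

section SpectralOrder

variable {A : Type*} [CStarAlgebra A] [PartialOrder A] [StarOrderedRing A]

lemma cfc_real_sqrt_star_mul_self (y : A) : cfc Real.sqrt (star y * y) = CFC.abs y := by
  rw [CFC.abs, CFC.sqrt_eq_real_sqrt _ (star_mul_self_nonneg y), cfcₙ_eq_cfc]

lemma abs_mul_one_sub_abs_nonneg {y : A} (hy : ‖y‖ ≤ 1) :
    0 ≤ CFC.abs y * (1 - CFC.abs y) := by
  have h : CFC.abs y ≤ 1 :=
    (CStarAlgebra.norm_le_one_iff_of_nonneg _ (CFC.abs_nonneg y)).1 (by rwa [CFC.norm_abs])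
  exact ((Commute.one_right _).sub_right (Commute.refl _)).mul_nonneg
    (CFC.abs_nonneg y) (sub_nonneg.2 h)

end SpectralOrder

/-- If `y` is a contraction, then `|y| (1 - |y|)` is of the form `c* c`. -/
lemma exists_star_mul_self_eq_sqrt_mul_one_sub_sqrt {A : Type*} [CStarAlgebra A] {y : A}
    (hy : ‖y‖ ≤ 1) :
    ∃ c : A, cfc Real.sqrt (star y * y) * (1 - cfc Real.sqrt (star y * y)) = star c * c := by
  let := CStarAlgebra.spectralOrder A
  have := CStarAlgebra.spectralOrderedRing A
  rw [cfc_real_sqrt_star_mul_self]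
  exact CStarAlgebra.nonneg_iff_eq_star_mul_self.1 (abs_mul_one_sub_abs_nonneg hy)

lemma cfc_real_sqrt_star_mul_self_sq {A : Type*} [CStarAlgebra A] (y : A) :
    cfc Real.sqrt (star y * y) ^ 2 = star y * y := by
  let := CStarAlgebra.spectralOrder A
  have := CStarAlgebra.spectralOrderedRing A
  rw [cfc_real_sqrt_star_mul_self, CFC.abs_sq]

/-- Let `ψ` be a state on a unital C*-algebra `A`, `y` a contraction with polar-type
decomposition `y = v |y|` for a unitary `v`.  Then
`ψ((v − y)*(v − y)) = ψ((1 − |y|)²) ≤ 1 − ψ(y* y)`, and if `0 < ε < 1` and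
`ψ(y* y)^{1/2} > 1 − ε²/8` then `ψ((v − y)*(v − y)) < ε²/4`. -/
theorem state_unitary_polar_estimate {A : Type*} [CStarAlgebra A]
    (ψ : A →ₗ[ℂ] ℂ) (hψ1 : ψ 1 = 1) (hψpos : ∀ x : A, 0 ≤ ψ (star x * x))
    (y : A) (hy : ‖y‖ ≤ 1) (v : A) (hv : v ∈ unitary A)
    (hyv : y = v * cfc Real.sqrt (star y * y)) :
    ψ (star (v - y) * (v - y)) = ψ ((1 - cfc Real.sqrt (star y * y)) ^ 2) ∧
    ψ (star (v - y) * (v - y)) ≤ 1 - ψ (star y * y) ∧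
    ∀ ε : ℝ, 0 < ε → ε < 1 → 1 - ε ^ 2 / 8 < Real.sqrt ((ψ (star y * y)).re) →
      (ψ (star (v - y) * (v - y))).re < ε ^ 2 / 4 := by
  have hsq := cfc_real_sqrt_star_mul_self_sq y
  obtain ⟨c, hc⟩ := exists_star_mul_self_eq_sqrt_mul_one_sub_sqrt hy
  have ha : star (cfc Real.sqrt (star y * y)) = cfc Real.sqrt (star y * y) :=
    cfc_predicate (R := ℝ) Real.sqrt (star y * y)
  generalize cfc Real.sqrt (star y * y) = a at hyv hsq hc ha ⊢
  have hpolar : star (v - y) * (v - y) = (1 - a) ^ 2 := by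
    have hvy : v - y = v * (1 - a) := by rw [hyv, mul_sub, mul_one]
    rw [hvy, star_mul, mul_assoc, ← mul_assoc (star v), Unitary.star_mul_self_of_mem hv, one_mul,
      star_sub, star_one, ha, sq]
  have hexpand : (1 - a) ^ 2 + (2 : ℂ) • (star c * c) = 1 - star y * y := by
    rw [← hc, ← hsq, two_smul]
    noncomm_ring
  have hψ : ψ ((1 - a) ^ 2) + 2 * ψ (star c * c) = 1 - ψ (star y * y) := by
    simpa [hψ1] using congrArg ψ hexpand
  have hle : ψ (star (v - y) * (v - y)) ≤ 1 - ψ (star y * y) := by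
    rw [hpolar, ← hψ]
    exact le_add_of_nonneg_right (mul_nonneg zero_le_two (hψpos c))
  refine ⟨by rw [hpolar], hle, fun ε hε hε1 hlt ↦ ?_⟩
  have hre := (Complex.le_def.1 hle).1
  rw [Complex.sub_re, Complex.one_re] at hre
  have hlower : (1 - ε ^ 2 / 8) ^ 2 < (ψ (star y * y)).re :=
    (Real.lt_sqrt (by nlinarith)).1 hlt
  nlinarith [sq_nonneg (ε ^ 2)]
end
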